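/- Let n be a positive integer and let G be either the path graph P_n, or (assuming n ≥ 3) the cycle graph C_n. If f is an efficient resolving broadcast of G, then f(v) ≤ 2 for every vertex v ∈ V(G). -/

import Mathlib

open SimpleGraph

/-- `f` is a resolving broadcast of `G`: for any two distinct vertices `x, y` there is a
vertex `z` with `f z > 0` such that `min (d(x,z)) (f z + 1) ≠ min (d(y,z)) (f z + 1)`,
where distances are extended naturals (`⊤` for vertices in different components). -/
def IsResolvingBroadcast {V : Type*} (G : SimpleGraph V) (f : V → ℕ) : Prop :=
  ∀ x y : V, x ≠ y → ∃ z : V, 0 < f z ∧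
    min (G.edist x z) ((f z : ℕ∞) + 1) ≠ min (G.edist y z) ((f z : ℕ∞) + 1)

/-- The broadcast dimension of `G`: the minimum of `∑ v, f v` over all
resolving broadcasts `f` of `G`. -/
noncomputable def bdim {V : Type*} [Fintype V] (G : SimpleGraph V) : ℕ :=
  sInf {n : ℕ | ∃ f : V → ℕ, IsResolvingBroadcast G f ∧ ∑ v, f v = n}

namespace SimpleGraph

variable {V : Type*} {G : SimpleGraph V}

lemma exists_adj_edist_eq_of_edist_eq_succ {x z : V} {d : ℕ} (h : G.edist x z = (d + 1 : ℕ)) :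
    ∃ y, G.Adj x y ∧ G.edist y z = d := by
  have hne : G.edist x z ≠ ⊤ := by rw [h]; exact ENat.natCast_ne_top _
  obtain ⟨p, hp⟩ := exists_walk_of_edist_ne_top hne
  rw [h] at hp
  have hp' : p.length = d + 1 := by exact_mod_cast hp
  cases p with
  | nil => simp at hp'
  | @cons _ y _ hxy q =>
    refine ⟨y, hxy, le_antisymm ?_ ?_⟩
    · have := edist_le q
      rw [Walk.length_cons] at hp'
      rwa [Nat.succ_injective hp'] at this
    · have h1 : G.edist x z ≤ 1 + G.edist y z := by
        have := G.edist_triangle (u := x) (v := y) (w := z)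
        rwa [edist_eq_one_iff_adj.2 hxy] at this
      rw [h, add_comm 1] at h1
      push_cast at h1
      exact (ENat.add_le_add_iff_right ENat.one_ne_top).1 h1

open Classical in
/-- The vertices of `G` at distance exactly `d` from `z`. -/
noncomputable def sphere [Fintype V] (G : SimpleGraph V) (z : V) (d : ℕ) : Finset V :=
  Finset.univ.filter fun x ↦ G.edist x z = d

lemma mem_sphere [Fintype V] {x z : V} {d : ℕ} : x ∈ G.sphere z d ↔ G.edist x z = d := by
  simp [sphere]

lemma sphere_zero [Fintype V] (z : V) : G.sphere z 0 = {z} := by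
  ext x; simp [mem_sphere]

/-- In a graph of maximum degree at most two, every sphere has at most two vertices. -/
lemma card_sphere_succ_le_two [Fintype V] [DecidableRel G.Adj] (hG : ∀ v, G.degree v ≤ 2)
    (z : V) (d : ℕ) : (G.sphere z (d + 1)).card ≤ 2 := by
  classical
  induction d with
  | zero =>
    refine le_trans (Finset.card_le_card fun x hx ↦ ?_) (hG z)
    rw [mem_sphere] at hx
    rw [mem_neighborFinset]
    exact (edist_eq_one_iff_adj.1 (by simpa using hx)).symm
  | succ d ih =>
    refine le_trans ?_ ih
    have H : ∀ x ∈ G.sphere z (d + 1 + 1), ∃ y, G.Adj x y ∧ G.edist y z = (d + 1 : ℕ) :=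
      fun x hx ↦ exists_adj_edist_eq_of_edist_eq_succ (mem_sphere.1 hx)
    choose! p hadj hp using H
    refine Finset.card_le_card_of_injOn p (fun x hx ↦ mem_sphere.2 (hp x hx)) ?_
    intro x hx y hy hxy
    by_contra hne
    obtain ⟨u, hu, hud⟩ := exists_adj_edist_eq_of_edist_eq_succ (hp x hx)
    have hx' := mem_sphere.1 hx
    have hy' := mem_sphere.1 hy
    have hsub : ({u, x, y} : Finset V) ⊆ G.neighborFinset (p x) := by
      intro t ht
      simp only [Finset.mem_insert, Finset.mem_singleton] at ht
      rw [mem_neighborFinset]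
      rcases ht with rfl | rfl | rfl
      · exact hu
      · exact (hadj _ hx).symm
      · rw [hxy]; exact (hadj _ hy).symm
    have hux : u ≠ x := by
      rintro rfl; rw [hud] at hx'; norm_cast at hx'; omega
    have huy : u ≠ y := by
      rintro rfl; rw [hud] at hy'; norm_cast at hy'; omega
    have hc : ({u, x, y} : Finset V).card = 3 := by
      rw [Finset.card_eq_three]; exact ⟨u, x, y, hux, huy, hne, rfl⟩
    have h1 := Finset.card_le_card hsub
    have h2 := hG (p x)
    rw [← card_neighborFinset_eq_degree] at h2
    omega

end SimpleGraph

namespace IsResolvingBroadcast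

variable {V : Type*} {G : SimpleGraph V} {f : V → ℕ}

/-- The vertex `x` hears the broadcast of `z`. -/
def Reaches (G : SimpleGraph V) (f : V → ℕ) (z x : V) : Prop :=
  0 < f z ∧ G.edist x z ≤ f z

open Classical in
/-- The vertices that hear the broadcast of `z`. -/
noncomputable def audience [Fintype V] (G : SimpleGraph V) (f : V → ℕ) (z : V) : Finset V :=
  Finset.univ.filter (Reaches G f z)

open Classical in
/-- The vertices that hear the broadcast of `z` and no other one. -/
noncomputable def privateAudience [Fintype V] (G : SimpleGraph V) (f : V → ℕ) (z : V) :
    Finset V :=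
  Finset.univ.filter fun x ↦ Reaches G f z x ∧ ∀ w, Reaches G f w x → w = z

lemma min_edist_of_not_reaches {x z : V} (hz : 0 < f z) (h : ¬ Reaches G f z x) :
    min (G.edist x z) ((f z : ℕ∞) + 1) = (f z : ℕ∞) + 1 :=
  min_eq_right (Order.add_one_le_of_lt (not_le.1 fun h' ↦ h ⟨hz, h'⟩))

lemma eq_of_not_reaches (hf : IsResolvingBroadcast G f) {x y : V}
    (hx : ∀ z, ¬ Reaches G f z x) (hy : ∀ z, ¬ Reaches G f z y) : x = y := by
  by_contra hne
  obtain ⟨z, hz, h⟩ := hf x y hne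
  exact h (by rw [min_edist_of_not_reaches hz (hx z), min_edist_of_not_reaches hz (hy z)])

variable [Fintype V]

lemma eq_of_mem_privateAudience (hf : IsResolvingBroadcast G f) {x y z : V}
    (hx : x ∈ privateAudience G f z) (hy : y ∈ privateAudience G f z)
    (hxy : G.edist x z = G.edist y z) : x = y := by
  simp only [privateAudience, Finset.mem_filter, Finset.mem_univ, true_and] at hx hy
  by_contra hne
  obtain ⟨w, hw, h⟩ := hf x y hne
  by_cases hwz : w = z
  · subst hwz; exact h (by rw [hxy])
  · exact h (by rw [min_edist_of_not_reaches hw fun h' ↦ hwz (hx.2 w h'),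
      min_edist_of_not_reaches hw fun h' ↦ hwz (hy.2 w h')])

lemma exists_mem_sphere_of_mem_audience {x z : V} (hx : x ∈ audience G f z) :
    ∃ d ≤ f z, x ∈ G.sphere z d := by
  simp only [audience, Finset.mem_filter, Finset.mem_univ, true_and] at hx
  have hne : G.edist x z ≠ ⊤ := ne_top_of_le_ne_top (ENat.natCast_ne_top _) hx.2
  obtain ⟨d, hd⟩ := ENat.ne_top_iff_exists.1 hne
  refine ⟨d, ?_, mem_sphere.2 hd.symm⟩
  have := hx.2
  rw [← hd] at this
  exact_mod_cast this

lemma privateAudience_subset_audience (z : V) :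
    privateAudience G f z ⊆ audience G f z := by
  intro x hx
  simp only [privateAudience, audience, Finset.mem_filter, Finset.mem_univ, true_and] at hx ⊢
  exact hx.1

lemma card_privateAudience_le_card (hf : IsResolvingBroadcast G f) {z : V} {s : Finset ℕ}
    (hs : ∀ x ∈ privateAudience G f z, G.dist x z ∈ s) :
    (privateAudience G f z).card ≤ s.card := by
  refine Finset.card_le_card_of_injOn (fun x ↦ G.dist x z) hs ?_
  intro x hx y hy hxy
  obtain ⟨d, -, hd⟩ := exists_mem_sphere_of_mem_audience (privateAudience_subset_audience z hx)
  obtain ⟨e, -, he⟩ := exists_mem_sphere_of_mem_audience (privateAudience_subset_audience z hy)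
  rw [mem_sphere] at hd he
  refine hf.eq_of_mem_privateAudience hx hy ?_
  simp only [SimpleGraph.dist, hd, he, ENat.toNat_natCast] at hxy
  rw [hd, he, hxy]

lemma dist_le_of_mem_privateAudience {x z : V} (hx : x ∈ privateAudience G f z) :
    G.dist x z ≤ f z := by
  obtain ⟨d, hd, hx⟩ := exists_mem_sphere_of_mem_audience (privateAudience_subset_audience z hx)
  rw [mem_sphere] at hx
  simpa [SimpleGraph.dist, hx] using hd

lemma card_privateAudience_le (hf : IsResolvingBroadcast G f) (z : V) :
    (privateAudience G f z).card ≤ f z + 1 := by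
  simpa using hf.card_privateAudience_le_card (z := z) (s := Finset.range (f z + 1))
    fun x hx ↦ Finset.mem_range_succ_iff.2 (dist_le_of_mem_privateAudience hx)

lemma card_privateAudience_le_of_self_notMem (hf : IsResolvingBroadcast G f) {z : V}
    (hz : z ∉ privateAudience G f z) : (privateAudience G f z).card ≤ f z := by
  have := hf.card_privateAudience_le_card (z := z) (s := Finset.Icc 1 (f z)) fun x hx ↦ by
    refine Finset.mem_Icc.2 ⟨?_, dist_le_of_mem_privateAudience hx⟩
    obtain ⟨d, hd, hxd⟩ :=
      exists_mem_sphere_of_mem_audience (privateAudience_subset_audience z hx)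
    rw [mem_sphere] at hxd
    simp only [SimpleGraph.dist, hxd, ENat.toNat_natCast]
    rcases Nat.eq_zero_or_pos d with rfl | h
    · simp only [Nat.cast_zero, edist_eq_zero_iff] at hxd
      exact absurd (hxd ▸ hx) hz
    · exact h
  simpa using this

lemma card_audience_le [DecidableRel G.Adj] (hG : ∀ v, G.degree v ≤ 2) {z : V}
    (hz : 0 < f z) :
    (audience G f z).card ≤ (G.sphere z 1).card + 2 * f z - 1 := by
  classical
  have hsub : audience G f z ⊆ (Finset.range (f z + 1)).biUnion (G.sphere z) := by
    intro x hx
    obtain ⟨d, hd, hxd⟩ := exists_mem_sphere_of_mem_audience hx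
    exact Finset.mem_biUnion.2 ⟨d, Finset.mem_range_succ_iff.2 hd, hxd⟩
  have h1 := (Finset.card_le_card hsub).trans Finset.card_biUnion_le
  obtain ⟨k, hk⟩ := Nat.exists_eq_succ_of_ne_zero hz.ne'
  rw [hk, Finset.sum_range_succ', Finset.sum_range_succ', sphere_zero] at h1
  have h2 : ∑ d ∈ Finset.range k, (G.sphere z (d + 1 + 1)).card ≤ k * 2 := by
    simpa using Finset.sum_le_card_nsmul (Finset.range k) _ 2
      fun d _ ↦ card_sphere_succ_le_two hG z (d + 1)
  simp only [Finset.card_singleton, zero_add] at h1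
  omega

lemma card_audience_eq_zero {z : V} (hz : f z = 0) : (audience G f z).card = 0 := by
  simp [audience, Reaches, hz]

lemma card_audience_add_card_privateAudience_le [DecidableRel G.Adj]
    (hf : IsResolvingBroadcast G f) (hG : ∀ v, G.degree v ≤ 2) (z : V) :
    (audience G f z).card + (privateAudience G f z).card ≤ 5 * f z := by
  rcases Nat.eq_zero_or_pos (f z) with h | h
  · have := card_audience_eq_zero (G := G) h
    have := Finset.card_le_card (privateAudience_subset_audience (G := G) (f := f) z)
    omega
  · have := card_audience_le hG h
    have := hf.card_privateAudience_le z
    have := card_sphere_succ_le_two hG z 0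
    rw [zero_add] at this
    omega

/-- Every vertex except at most one hears some broadcast, and a vertex that hears only one
broadcast lies in a private audience. -/
lemma two_mul_card_le_sum (hf : IsResolvingBroadcast G f) :
    2 * Fintype.card V ≤
      ∑ z, ((audience G f z).card + (privateAudience G f z).card) + 2 := by
  classical
  have hswap : ∑ z, ((audience G f z).card + (privateAudience G f z).card) =
      ∑ x, ((Finset.univ.filter fun z ↦ Reaches G f z x).card +
        (Finset.univ.filter fun z ↦ Reaches G f z x ∧ ∀ w, Reaches G f w x → w = z).card) := by
    simp only [audience, privateAudience, Finset.sum_add_distrib, Finset.card_filter]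
    congr 1 <;> exact Finset.sum_comm
  have hun : (Finset.univ.filter fun x ↦ ∀ z, ¬ Reaches G f z x).card ≤ 1 :=
    Finset.card_le_one.2 fun x hx y hy ↦ hf.eq_of_not_reaches
      (Finset.mem_filter.1 hx).2 (Finset.mem_filter.1 hy).2
  have hpt : ∑ _x : V, 2 ≤
      ∑ x, ((Finset.univ.filter fun z ↦ Reaches G f z x).card +
        (Finset.univ.filter fun z ↦ Reaches G f z x ∧ ∀ w, Reaches G f w x → w = z).card) +
      ∑ x, 2 * (if ∀ z, ¬ Reaches G f z x then 1 else 0) := by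
    rw [← Finset.sum_add_distrib]
    refine Finset.sum_le_sum fun x _ ↦ ?_
    by_cases hx : ∀ z, ¬ Reaches G f z x
    · simp [hx]
    · rw [if_neg hx]
      push Not at hx
      obtain ⟨z, hz⟩ := hx
      have hz1 : 0 < (Finset.univ.filter fun z ↦ Reaches G f z x).card :=
        Finset.card_pos.2 ⟨z, by simpa using hz⟩
      by_cases hu : ∀ w, Reaches G f w x → w = z
      · have : 0 < (Finset.univ.filter fun z ↦
            Reaches G f z x ∧ ∀ w, Reaches G f w x → w = z).card :=
          Finset.card_pos.2 ⟨z, by simpa using ⟨hz, hu⟩⟩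
        omega
      · push Not at hu
        obtain ⟨w, hw, hwz⟩ := hu
        have : 1 < (Finset.univ.filter fun z ↦ Reaches G f z x).card :=
          Finset.one_lt_card.2 ⟨w, by simpa using hw, z, by simpa using hz, hwz⟩
        omega
  rw [← Finset.mul_sum, ← Finset.card_filter, ← hswap] at hpt
  simp only [Finset.sum_const, Finset.card_univ, smul_eq_mul] at hpt
  omega

/-- In a graph of maximum degree at most two, a resolving broadcast with a value at least three
is expensive. -/
lemma two_mul_card_add_three_le [DecidableRel G.Adj] (hf : IsResolvingBroadcast G f)
    (hG : ∀ v, G.degree v ≤ 2) {v : V} (hv : 3 ≤ f v) :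
    2 * Fintype.card V + 3 ≤ 5 * ∑ z, f z := by
  classical
  have hle := hf.card_audience_add_card_privateAudience_le hG
  suffices ∑ z, ((audience G f z).card + (privateAudience G f z).card) + 5 ≤ 5 * ∑ z, f z by
    have := hf.two_mul_card_le_sum
    omega
  have hav := card_audience_le (f := f) hG (z := v) (by omega)
  have hpv := hf.card_privateAudience_le v
  rw [Finset.mul_sum]
  by_cases hpriv : G.sphere v 1 ⊆ privateAudience G f v
  · have h1 : (G.sphere v 1).card ≤ 1 := Finset.card_le_one.2 fun x hx y hy ↦
      hf.eq_of_mem_privateAudience (hpriv hx) (hpriv hy)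
        ((mem_sphere.1 hx).trans (mem_sphere.1 hy).symm)
    have h5 : ∑ z, (if z = v then 5 else 0) = 5 := by simp
    refine le_trans (Nat.add_le_add_left h5.ge _) ?_
    rw [← Finset.sum_add_distrib]
    refine Finset.sum_le_sum fun z _ ↦ ?_
    split_ifs with hz
    · subst hz; omega
    · exact hle z
  · obtain ⟨x, hx, hxp⟩ := Finset.not_subset.1 hpriv
    have h1 := card_sphere_succ_le_two hG v 0
    rw [zero_add] at h1
    rw [mem_sphere] at hx
    have hvx : Reaches G f v x :=
      ⟨by omega, by rw [hx]; exact_mod_cast (by omega : 1 ≤ f v)⟩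
    obtain ⟨w, hwx, hwv⟩ : ∃ w, Reaches G f w x ∧ w ≠ v := by
      by_contra! h
      exact hxp (by simpa [privateAudience] using ⟨hvx, h⟩)
    have hw : (audience G f w).card + (privateAudience G f w).card + 1 ≤ 5 * f w := by
      have haw := card_audience_le (f := f) hG (z := w) hwx.1
      have hpw := hf.card_privateAudience_le w
      have h1w := card_sphere_succ_le_two hG w 0
      rw [zero_add] at h1w
      by_cases hw2 : 2 ≤ f w
      · omega
      · have hw1 : f w = 1 := by have := hwx.1; omega
        have hself : w ∉ privateAudience G f w := by
          intro hmem
          simp only [privateAudience, Finset.mem_filter, Finset.mem_univ, true_and] at hmem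
          refine hwv (hmem.2 v ⟨by omega, ?_⟩).symm
          calc G.edist w v ≤ G.edist w x + G.edist x v := G.edist_triangle
            _ ≤ 1 + 1 := by
              gcongr
              · rw [SimpleGraph.edist_comm]; simpa [hw1] using hwx.2
              · rw [hx]; simp
            _ ≤ f v := by exact_mod_cast (by omega : 1 + 1 ≤ f v)
        have := hf.card_privateAudience_le_of_self_notMem hself
        omega
    have h5 : ∑ z, ((if z = v then 4 else 0) + (if z = w then 1 else 0)) = 5 := by
      simp [Finset.sum_add_distrib]
    refine le_trans (Nat.add_le_add_left h5.ge _) ?_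
    rw [← Finset.sum_add_distrib]
    refine Finset.sum_le_sum fun z _ ↦ ?_
    by_cases hzv : z = v
    · subst hzv
      rw [if_pos rfl, if_neg hwv.symm]
      omega
    · rw [if_neg hzv]
      split_ifs with hzw
      · subst hzw; omega
      · simpa using hle z

end IsResolvingBroadcast

namespace SimpleGraph

lemma cycleGraph_adj_iff_val {n : ℕ} (hn : 3 ≤ n) {u v : Fin n} :
    (cycleGraph n).Adj u v ↔ u.val + 1 = v.val ∨ v.val + 1 = u.val ∨
      (u.val = 0 ∧ v.val + 1 = n) ∨ (v.val = 0 ∧ u.val + 1 = n) := by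
  rw [cycleGraph_adj']
  rcases lt_trichotomy u v with h | rfl | h
  · rw [Fin.coe_sub_iff_lt.2 h, Fin.coe_sub_iff_le.2 h.le]
    have : u.val < v.val := h
    omega
  · simp only [Fin.sub_val_of_le le_rfl]
    omega
  · rw [Fin.coe_sub_iff_le.2 h.le, Fin.coe_sub_iff_lt.2 h]
    have : v.val < u.val := h
    omega

lemma cycleGraph_degree_le_two {n : ℕ} (v : Fin n) : (cycleGraph n).degree v ≤ 2 := by
  match n with
  | 0 => exact v.elim0
  | 1 => exact ((cycleGraph 1).degree_lt_card_verts v).le.trans (by simp)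
  | 2 => exact ((cycleGraph 2).degree_lt_card_verts v).le.trans (by simp)
  | n + 3 => exact cycleGraph_degree_three_le.le

end SimpleGraph

lemma bdim_le {V : Type*} [Fintype V] {G : SimpleGraph V} {f : V → ℕ}
    (hf : IsResolvingBroadcast G f) : bdim G ≤ ∑ v, f v :=
  Nat.sInf_le ⟨f, hf, rfl⟩

/-- A broadcast is resolving as soon as any two vertices of value `0` are told apart by adjacency
to some vertex of value `1`. -/
lemma isResolvingBroadcast_of_adj {V : Type*} {G : SimpleGraph V} {f : V → ℕ}
    (h : ∀ x y, x ≠ y → f x = 0 → f y = 0 → ∃ z, f z = 1 ∧ ¬ (G.Adj x z ↔ G.Adj y z)) :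
    IsResolvingBroadcast G f := by
  have far : ∀ {x z : V}, x ≠ z → ¬ G.Adj x z → (1 + 1 : ℕ∞) ≤ G.edist x z := by
    intro x z hne hadj
    refine Order.add_one_le_of_lt (not_le.1 fun h ↦ ?_)
    exact (edist_le_one_iff_adj_or_eq.1 h).elim hadj hne
  intro x y hxy
  by_cases hx : f x = 0
  · by_cases hy : f y = 0
    · obtain ⟨z, hz, hxyz⟩ := h x y hxy hx hy
      have hxz : x ≠ z := by rintro rfl; omega
      have hyz : y ≠ z := by rintro rfl; omega
      refine ⟨z, by omega, ?_⟩
      rw [hz, Nat.cast_one]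
      by_cases hax : G.Adj x z
      · have hay : ¬ G.Adj y z := fun h ↦ hxyz (iff_of_true hax h)
        rw [min_eq_right (far hyz hay), edist_eq_one_iff_adj.2 hax]
        decide
      · have hay : G.Adj y z := by
          by_contra h; exact hxyz (iff_of_false hax h)
        rw [min_eq_right (far hxz hax), edist_eq_one_iff_adj.2 hay]
        decide
    · refine ⟨y, by omega, fun h ↦ ?_⟩
      simp [min_eq_iff, hxy] at h
  · refine ⟨x, by omega, fun h ↦ ?_⟩
    replace h := h.symm
    simp [min_eq_iff, hxy.symm] at h

/-- The support of a cheap resolving broadcast of `P n` and, for `n ≥ 5`, of `C n`: the vertices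
congruent to `1` or `3` modulo `5`, the last one being moved by one step if `n % 5 = 3`. -/
def IsCenter (n i : ℕ) : Prop :=
  (i % 5 = 1 ∧ ¬ (n % 5 = 3 ∧ i + 2 = n)) ∨ i % 5 = 3 ∨ (n % 5 = 3 ∧ i + 1 = n)

instance (n i : ℕ) : Decidable (IsCenter n i) := by unfold IsCenter; infer_instance

lemma sum_range_mod_five (n : ℕ) :
    ∑ i ∈ Finset.range n, (if i % 5 = 1 ∨ i % 5 = 3 then 1 else 0) = (2 * n + 2) / 5 := by
  induction n with
  | zero => simp
  | succ n ih => rw [Finset.sum_range_succ, ih]; split_ifs <;> omega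

lemma sum_isCenter (n : ℕ) :
    ∑ i : Fin n, (if IsCenter n i then 1 else 0) = (2 * n + 2) / 5 := by
  rw [Fin.sum_univ_eq_sum_range (fun i ↦ if IsCenter n i then 1 else 0), ← sum_range_mod_five]
  by_cases h : n % 5 = 3
  · obtain ⟨k, rfl⟩ : ∃ k, n = k + 2 := ⟨n - 2, by omega⟩
    simp only [Finset.sum_range_succ]
    rw [if_neg (by unfold IsCenter; omega), if_pos (by unfold IsCenter; omega),
      if_pos (by omega), if_neg (by omega), add_right_comm]
    congr 2
    refine Finset.sum_congr rfl fun i hi ↦ if_congr ?_ rfl rfl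
    rw [Finset.mem_range] at hi
    unfold IsCenter
    omega
  · refine Finset.sum_congr rfl fun i _ ↦ if_congr ?_ rfl rfl
    unfold IsCenter
    omega

lemma exists_isCenter_path {n x y : ℕ} (hx : x < n) (hy : y < n) (hxy : x < y)
    (hx' : ¬ IsCenter n x) (hy' : ¬ IsCenter n y) :
    ∃ z < n, IsCenter n z ∧ ¬ ((x + 1 = z ∨ z + 1 = x) ↔ (y + 1 = z ∨ z + 1 = y)) := by
  unfold IsCenter at *
  by_cases h0 : x % 5 = 0
  · by_cases h3 : n = x + 3
    · exact ⟨x + 2, by omega, by omega, by omega⟩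
    · by_cases h2 : y = x + 2
      · exact ⟨y + 1, by omega, by omega, by omega⟩
      · exact ⟨x + 1, by omega, by omega, by omega⟩
  · exact ⟨x - 1, by omega, by omega, by omega⟩

lemma exists_isCenter_cycle {n x y : ℕ} (hn : 5 ≤ n) (hx : x < n) (hy : y < n) (hxy : x < y)
    (hx' : ¬ IsCenter n x) (hy' : ¬ IsCenter n y) :
    ∃ z < n, IsCenter n z ∧
      ¬ ((x + 1 = z ∨ z + 1 = x ∨ (x = 0 ∧ z + 1 = n) ∨ (z = 0 ∧ x + 1 = n)) ↔
        (y + 1 = z ∨ z + 1 = y ∨ (y = 0 ∧ z + 1 = n) ∨ (z = 0 ∧ y + 1 = n))) := by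
  unfold IsCenter at *
  by_cases h0 : x % 5 = 0
  · by_cases h3 : n = x + 3
    · exact ⟨x + 2, by omega, by omega, by omega⟩
    · by_cases h2 : y = x + 2
      · exact ⟨y + 1, by omega, by omega, by omega⟩
      · exact ⟨x + 1, by omega, by omega, by omega⟩
  · exact ⟨x - 1, by omega, by omega, by omega⟩

lemma bdim_pathGraph_le (n : ℕ) : bdim (pathGraph n) ≤ (2 * n + 2) / 5 := by
  rw [← sum_isCenter]
  refine bdim_le (isResolvingBroadcast_of_adj ?_)
  intro x y hxy hx hy
  wlog hlt : x < y generalizing x y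
  · obtain ⟨z, hz, h⟩ := this y x hxy.symm hy hx (lt_of_le_of_ne (not_lt.1 hlt) hxy.symm)
    exact ⟨z, hz, fun h' ↦ h h'.symm⟩
  obtain ⟨z, hzn, hz, h⟩ := exists_isCenter_path x.2 y.2 hlt (by simpa using hx) (by simpa using hy)
  exact ⟨⟨z, hzn⟩, by simpa using hz, by simpa only [pathGraph_adj] using h⟩

lemma bdim_cycleGraph_le {n : ℕ} (hn : 5 ≤ n) : bdim (cycleGraph n) ≤ (2 * n + 2) / 5 := by
  rw [← sum_isCenter]
  refine bdim_le (isResolvingBroadcast_of_adj ?_)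
  intro x y hxy hx hy
  wlog hlt : x < y generalizing x y
  · obtain ⟨z, hz, h⟩ := this y x hxy.symm hy hx (lt_of_le_of_ne (not_lt.1 hlt) hxy.symm)
    exact ⟨z, hz, fun h' ↦ h h'.symm⟩
  obtain ⟨z, hzn, hz, h⟩ :=
    exists_isCenter_cycle hn x.2 y.2 hlt (by simpa using hx) (by simpa using hy)
  exact ⟨⟨z, hzn⟩, by simpa using hz,
    by simpa only [cycleGraph_adj_iff_val (by omega : 3 ≤ n)] using h⟩

lemma bdim_cycleGraph_three_le : bdim (cycleGraph 3) ≤ 2 :=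
  bdim_le (f := ![1, 1, 0]) (isResolvingBroadcast_of_adj (by decide))

lemma bdim_cycleGraph_four_le : bdim (cycleGraph 4) ≤ 2 :=
  bdim_le (f := ![1, 1, 0, 0]) (isResolvingBroadcast_of_adj (by decide))

/-- If `G` is the path `P n` (with `n ≥ 1`) or the cycle `C n` (with `n ≥ 3`) and
`f` is an efficient resolving broadcast of `G`, then `f v ≤ 2` for every vertex. -/
theorem efficient_broadcast_path_cycle_le_two (n : ℕ) (hn : 0 < n)
    (G : SimpleGraph (Fin n))
    (hG : G = pathGraph n ∨ (3 ≤ n ∧ G = cycleGraph n))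
    (f : Fin n → ℕ) (hf : IsResolvingBroadcast G f)
    (heff : ∑ w, f w = bdim G) :
    ∀ w : Fin n, f w ≤ 2 := by
  classical
  by_contra! h
  obtain ⟨w, hw⟩ := h
  have hdeg : ∀ v, G.degree v ≤ 2 := by
    intro v
    have hle : G ≤ cycleGraph n := by
      rcases hG with rfl | ⟨-, rfl⟩
      · exact pathGraph_le_cycleGraph
      · exact le_rfl
    exact (degree_le_of_le hle).trans (cycleGraph_degree_le_two v)
  have hlow := hf.two_mul_card_add_three_le hdeg hw
  rw [Fintype.card_fin] at hlow
  have hsum : f w ≤ ∑ v, f v := Finset.single_le_sum_of_canonicallyOrdered (Finset.mem_univ w)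
  rcases hG with rfl | ⟨h3, rfl⟩
  · have := bdim_pathGraph_le n
    omega
  · rcases (by omega : n = 3 ∨ n = 4 ∨ 5 ≤ n) with rfl | rfl | h5
    · have := bdim_cycleGraph_three_le
      omega
    · have := bdim_cycleGraph_four_le
      omega
    · have := bdim_cycleGraph_le h5
      omega
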